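/- If the edge list covers vertices, then the minimum over all y ∈ ℤ^n of Σ_{j=1}^{2m} |(B·y − t)_j|^p exists and equals m + (ι^p − 1)·(m − M), where M = max_{b ∈ {0,1}^n} cut(b) is the maximum cut value of the graph. In other words, the p-th power of the distance from the lattice generated by B to the target t is determined exactly by the maximum cut of the underlying graph. -/

import Mathlib

open Finset Matrix

/-- The matrix of the (unweighted) Max-Cut-to-CVP reduction. The ambient
dimension `2m` is indexed by `Fin m × Bool`, where `(k, false)` is the
coordinate `2k-1` and `(k, true)` is the coordinate `2k` of the paper. -/
noncomputable def Bmat {n m : ℕ} (ι : ℝ) (E : Fin m → Fin n × Fin n) :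
    Matrix (Fin m × Bool) (Fin n) ℝ := fun j i =>
  if j.2 then
    (if i = (E j.1).1 then ι else 0) + (if i = (E j.1).2 then ι else 0)
  else
    (if i = (E j.1).1 then (-1 : ℝ) else 0) + (if i = (E j.1).2 then 1 else 0)

/-- The target vector of the reduction: `t_{2k-1} = 0`, `t_{2k} = ι`. -/
noncomputable def tvec (m : ℕ) (ι : ℝ) : Fin m × Bool → ℝ := fun j => if j.2 then ι else 0

/-- The `ℓ_p` norm `(∑ j, |x j| ^ p) ^ (1/p)` (real exponents). -/
noncomputable def lpNorm {d : Type*} [Fintype d] (p : ℝ) (x : d → ℝ) : ℝ :=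
  (∑ j, |x j| ^ p) ^ (1 / p)

/-- A binary vector `b ∈ {0,1}^n`, as a real vector. -/
def binVec {n : ℕ} (b : Fin n → Bool) : Fin n → ℝ := fun i => if b i then 1 else 0

/-- An integer vector `y ∈ ℤ^n`, as a real vector. -/
def intVec {n : ℕ} (y : Fin n → ℤ) : Fin n → ℝ := fun i => (y i : ℝ)

/-- The number of edges cut by the partition described by `b`. -/
def cut {n m : ℕ} (E : Fin m → Fin n × Fin n) (b : Fin n → Bool) : ℕ :=
  (Finset.univ.filter fun k => b (E k).1 ≠ b (E k).2).card

/-- The edge list covers vertices: every vertex is an endpoint of some edge. -/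
def Covers {n m : ℕ} (E : Fin m → Fin n × Fin n) : Prop :=
  ∀ i : Fin n, ∃ k : Fin m, (E k).1 = i ∨ (E k).2 = i

/-- The binarization of an integer vector: `0` if `y i ≤ 0`, `1` if `y i ≥ 1`. -/
def binarize {n : ℕ} (y : Fin n → ℤ) : Fin n → Bool := fun i => decide (1 ≤ y i)

lemma Bmat_mulVec_sub_tvec_false {n m : ℕ} (ι : ℝ) (E : Fin m → Fin n × Fin n)
    (x : Fin n → ℝ) (k : Fin m) :
    ((Bmat ι E).mulVec x - tvec m ι) (k, false) = x (E k).2 - x (E k).1 := by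
  simp [Bmat, tvec, Matrix.mulVec, dotProduct, add_mul, Finset.sum_add_distrib]
  ring

lemma Bmat_mulVec_sub_tvec_true {n m : ℕ} (ι : ℝ) (E : Fin m → Fin n × Fin n)
    (x : Fin n → ℝ) (k : Fin m) :
    ((Bmat ι E).mulVec x - tvec m ι) (k, true) = ι * (x (E k).1 + x (E k).2 - 1) := by
  simp [Bmat, tvec, Matrix.mulVec, dotProduct, add_mul, Finset.sum_add_distrib]
  ring

lemma sum_abs_Bmat_mulVec_sub_tvec_rpow {n m : ℕ} (p ι : ℝ) (E : Fin m → Fin n × Fin n)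
    (x : Fin n → ℝ) :
    ∑ j, |((Bmat ι E).mulVec x - tvec m ι) j| ^ p =
      ∑ k, (|ι * (x (E k).1 + x (E k).2 - 1)| ^ p + |x (E k).2 - x (E k).1| ^ p) := by
  simp only [Fintype.sum_prod_type, Fintype.sum_bool, Bmat_mulVec_sub_tvec_false,
    Bmat_mulVec_sub_tvec_true]

lemma sum_cut_cost {n m : ℕ} (c : ℝ) (E : Fin m → Fin n × Fin n) (b : Fin n → Bool) :
    ∑ k, (if b (E k).1 ≠ b (E k).2 then 1 else c) =
      (m : ℝ) + (c - 1) * ((m : ℝ) - (cut E b : ℝ)) := by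
  have h : ∀ k, (if b (E k).1 ≠ b (E k).2 then 1 else c) =
      c + (1 - c) * (if b (E k).1 ≠ b (E k).2 then 1 else 0) := by
    intro k
    split_ifs <;> ring
  simp only [h, Finset.sum_add_distrib, ← Finset.mul_sum, Finset.sum_boole, cut]
  simp
  ring

lemma one_le_abs_intCast_rpow {p : ℝ} (hp : 0 ≤ p) {z : ℤ} (hz : z ≠ 0) :
    1 ≤ |(z : ℝ)| ^ p :=
  Real.one_le_rpow (by exact_mod_cast Int.one_le_abs hz) hp

/-- Rounding the endpoints of an edge to `{0,1}` does not increase the edge's cost. -/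
lemma binarized_edge_cost_le {p ι : ℝ} (hp : 0 ≤ p) (hι : 1 ≤ ι) (u v : ℤ) :
    (if decide (1 ≤ u) ≠ decide (1 ≤ v) then 1 else ι ^ p) ≤
      |ι * ((u : ℝ) + v - 1)| ^ p + |(v : ℝ) - u| ^ p := by
  have hιp : 1 ≤ ι ^ p := Real.one_le_rpow hι hp
  by_cases h : u + v = 1
  · have hne : decide (1 ≤ u) ≠ decide (1 ≤ v) := by
      rw [Ne, decide_eq_decide]
      omega
    have hd := one_le_abs_intCast_rpow hp (show v - u ≠ 0 by omega)
    push_cast at hd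
    rw [if_pos hne]
    exact hd.trans (le_add_of_nonneg_left (by positivity))
  · have hs := one_le_abs_intCast_rpow hp (show u + v - 1 ≠ 0 by omega)
    push_cast at hs
    have hle : ι ^ p ≤ |ι * ((u : ℝ) + v - 1)| ^ p := by
      rw [abs_mul, Real.mul_rpow (abs_nonneg _) (abs_nonneg _), abs_of_nonneg (by linarith)]
      exact le_mul_of_one_le_right (by linarith) hs
    have hd : 0 ≤ |(v : ℝ) - u| ^ p := by positivity
    split_ifs <;> linarith

lemma binary_edge_cost {p ι : ℝ} (hp : p ≠ 0) (hι : 0 ≤ ι) (a b : Bool) :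
    |ι * ((if a then 1 else 0) + (if b then 1 else 0) - 1)| ^ p +
      |(if b then (1 : ℝ) else 0) - (if a then 1 else 0)| ^ p =
        if a ≠ b then 1 else ι ^ p := by
  cases a <;> cases b <;> simp [hp, abs_of_nonneg hι]

/-- the minimum over `y ∈ ℤ^n` of `∑ j, |(B·y − t)_j|^p` exists and
equals `m + (ι^p − 1)·(m − M)` where `M` is the maximum cut value. -/
theorem stmt8 (n m : ℕ) (hn : 0 < n) (hm : 0 < m) (p : ℝ) (hp : 1 ≤ p) (ι : ℝ) (hι : 1 < ι)
    (E : Fin m → Fin n × Fin n) (hE : ∀ k, (E k).1 ≠ (E k).2)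
    (hcov : Covers E) :
    IsLeast {r : ℝ | ∃ y : Fin n → ℤ,
        r = ∑ j, |((Bmat ι E).mulVec (intVec y) - tvec m ι) j| ^ p}
      ((m : ℝ) + (ι ^ p - 1) *
        ((m : ℝ) - ((Finset.univ.sup fun b : Fin n → Bool => cut E b : ℕ) : ℝ))) := by
  have hp0 : 0 ≤ p := by linarith
  have hι0 : 0 ≤ ι := by linarith
  constructor
  · obtain ⟨b, -, hb⟩ := Finset.exists_mem_eq_sup (Finset.univ : Finset (Fin n → Bool))
      Finset.univ_nonempty (cut E)
    refine ⟨fun i => if b i then 1 else 0, ?_⟩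
    rw [sum_abs_Bmat_mulVec_sub_tvec_rpow, hb, ← sum_cut_cost]
    refine Finset.sum_congr rfl fun k _ => ?_
    rw [← binary_edge_cost (by linarith) hι0]
    simp [intVec]
  · rintro _ ⟨y, rfl⟩
    have hcut : (cut E (binarize y) : ℝ) ≤
        ((Finset.univ.sup fun b : Fin n → Bool => cut E b : ℕ) : ℝ) := by
      exact_mod_cast Finset.le_sup (f := fun b : Fin n → Bool => cut E b)
        (Finset.mem_univ (binarize y))
    have hιp : 0 ≤ ι ^ p - 1 := sub_nonneg.2 (Real.one_le_rpow hι.le hp0)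
    calc _ ≤ (m : ℝ) + (ι ^ p - 1) * ((m : ℝ) - (cut E (binarize y) : ℝ)) := by gcongr
      _ = ∑ k, (if binarize y (E k).1 ≠ binarize y (E k).2 then 1 else ι ^ p) :=
        (sum_cut_cost _ E _).symm
      _ ≤ _ := by
        rw [sum_abs_Bmat_mulVec_sub_tvec_rpow]
        exact Finset.sum_le_sum fun k _ => binarized_edge_cost_le hp0 hι.le _ _
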